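/- For every integer i, one has a_i† a_i = a_{i−1} a_{i−1}† − a_i a_i† (monotone rule (3.3)). -/

import Mathlib

noncomputable section

open ContinuousLinearMap

/-- The discrete monotone Fock space: `ℓ²` over the finite subsets of `ℤ`. -/
abbrev MF : Type := lp (fun _ : Finset ℤ => ℂ) 2

/-- The canonical orthonormal basis vector corresponding to a finite subset `S ⊆ ℤ`;
`eS ∅` is the vacuum vector `Ω`. -/
noncomputable def eS (S : Finset ℤ) : MF := lp.single 2 S 1

/-- `a : ℤ → MF →L[ℂ] MF` is the family of monotone annihilation operators:
`a i (eS S) = eS (S \ {i})` if `S` is nonempty with `min S = i`, and `a i (eS S) = 0`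
otherwise.  The creation operator `a_i†` is the Hilbert-space adjoint of `a i`. -/
def IsMonotoneAnnihilation (a : ℤ → MF →L[ℂ] MF) : Prop :=
  ∀ (i : ℤ) (S : Finset ℤ),
    (S.min = (i : WithBot ℤ) → a i (eS S) = eS (S.erase i)) ∧
    (S.min ≠ (i : WithBot ℤ) → a i (eS S) = 0)

theorem inner_eS_left (S : Finset ℤ) (f : MF) : inner ℂ (eS S) f = f S := by
  simp [eS, lp.inner_single_left]

theorem inner_eS_eS (S T : Finset ℤ) : inner ℂ (eS S) (eS T) = if S = T then (1 : ℂ) else 0 := by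
  rw [inner_eS_left, eS, lp.single_apply, Pi.single_apply]

/-- Two bounded operators on `MF` agreeing on the canonical basis are equal. -/
theorem MF_clm_ext {f g : MF →L[ℂ] MF} (h : ∀ S, f (eS S) = g (eS S)) : f = g := by
  refine lp.ext_continuousLinearMap (by simp) fun S => ?_
  ext1
  exact h S

theorem min_eq_coe_iff (S : Finset ℤ) (i : ℤ) :
    S.min = (i : WithTop ℤ) ↔ i ∈ S ∧ ∀ x ∈ S, i ≤ x := by
  refine ⟨fun h => ⟨Finset.mem_of_min h, fun x hx => Finset.min_le_of_eq hx h⟩, fun h => ?_⟩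
  exact le_antisymm (Finset.min_le h.1) (Finset.le_min fun x hx => WithTop.coe_le_coe.2 (h.2 x hx))

namespace IsMonotoneAnnihilation

variable {a : ℤ → MF →L[ℂ] MF}

theorem apply_eS (ha : IsMonotoneAnnihilation a) (i : ℤ) (S : Finset ℤ) :
    a i (eS S) = if i ∈ S ∧ ∀ x ∈ S, i ≤ x then eS (S.erase i) else 0 := by
  split_ifs with h
  · exact (ha i S).1 ((min_eq_coe_iff S i).2 h)
  · exact (ha i S).2 fun h' => h ((min_eq_coe_iff S i).1 h')

theorem adjoint_apply_eS (ha : IsMonotoneAnnihilation a) (i : ℤ) (S : Finset ℤ) :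
    adjoint (a i) (eS S) = if ∀ x ∈ S, i < x then eS (insert i S) else 0 := by
  ext T
  rw [← inner_eS_left, ← inner_eS_left, adjoint_inner_right, ha.apply_eS]
  have key : ((i ∈ T ∧ ∀ x ∈ T, i ≤ x) ∧ T.erase i = S) ↔
      ((∀ x ∈ S, i < x) ∧ T = insert i S) := by
    constructor
    · rintro ⟨⟨hi, hT⟩, rfl⟩
      refine ⟨fun x hx => ?_, (Finset.insert_erase hi).symm⟩
      exact lt_of_le_of_ne (hT x (Finset.mem_of_mem_erase hx)) (Finset.ne_of_mem_erase hx).symm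
    · rintro ⟨hS, rfl⟩
      refine ⟨⟨Finset.mem_insert_self i S, fun x hx => ?_⟩,
        Finset.erase_insert fun h => lt_irrefl i (hS i h)⟩
      rcases Finset.mem_insert.1 hx with rfl | hx
      exacts [le_rfl, (hS x hx).le]
  split_ifs with h₁ h₂ h₂ <;> simp only [inner_eS_eS, inner_zero_left, inner_zero_right] <;> grind

/-- `a_i† a_i` is the projection onto the span of the `eS S` with `min S = i`. -/
theorem adjoint_apply_apply_eS (ha : IsMonotoneAnnihilation a) (i : ℤ) (S : Finset ℤ) :
    adjoint (a i) (a i (eS S)) = if i ∈ S ∧ ∀ x ∈ S, i ≤ x then eS S else 0 := by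
  rw [ha.apply_eS]
  split_ifs with h
  · rw [ha.adjoint_apply_eS, Finset.insert_erase h.1, if_pos]
    exact fun x hx =>
      lt_of_le_of_ne (h.2 x (Finset.mem_of_mem_erase hx)) (Finset.ne_of_mem_erase hx).symm
  · exact map_zero _

/-- `a_i a_i†` is the projection onto the span of the `eS S` with `i` below all of `S`. -/
theorem apply_adjoint_apply_eS (ha : IsMonotoneAnnihilation a) (i : ℤ) (S : Finset ℤ) :
    a i (adjoint (a i) (eS S)) = if ∀ x ∈ S, i < x then eS S else 0 := by
  rw [ha.adjoint_apply_eS]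
  split_ifs with h
  · rw [ha.apply_eS, Finset.erase_insert fun hi => lt_irrefl i (h i hi), if_pos]
    exact ⟨Finset.mem_insert_self i S,
      fun x hx => (Finset.mem_insert.1 hx).elim (fun e => e.ge) fun hx => (h x hx).le⟩
  · exact map_zero _

end IsMonotoneAnnihilation

/-- Monotone rule (3.3): `a_i† a_i = a_{i-1} a_{i-1}† − a_i a_i†`. -/
theorem stmt4 (a : ℤ → MF →L[ℂ] MF) (ha : IsMonotoneAnnihilation a) (i : ℤ) :
    (adjoint (a i)).comp (a i) =
      (a (i - 1)).comp (adjoint (a (i - 1))) - (a i).comp (adjoint (a i)) := by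
  refine MF_clm_ext fun S => ?_
  simp only [sub_apply, comp_apply, ha.adjoint_apply_apply_eS, ha.apply_adjoint_apply_eS]
  have hle : (∀ x ∈ S, i - 1 < x) ↔ ∀ x ∈ S, i ≤ x := by simp only [Int.sub_one_lt_iff]
  have hlt : (∀ x ∈ S, i < x) ↔ i ∉ S ∧ ∀ x ∈ S, i ≤ x := by
    grind
  rw [if_congr hle rfl rfl, if_congr hlt rfl rfl]
  by_cases h : ∀ x ∈ S, i ≤ x <;> by_cases hi : i ∈ S <;> simp [h, hi]
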